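/- arXiv:2102.01320 — 6 statements merged into one kernel-verified Lean document; each statement's English description precedes it below -/
import Mathlib

section
/- A binary function is stable if and only if it has no minor isomorphic to f_{-1}, the order-one binary function taking the value -1 on the singleton. -/
/-- A binary function on finite ground set `E`: a function `f : 2^E → ℝ` with `f ∅ = 1`.
(The function is defined on all finite sets; only its values on subsets of `E` matter.) -/
structure BinaryFunction (α : Type) [DecidableEq α] where
  E : Finset α
  f : Finset α → ℝ
  empty_one : f ∅ = 1

namespace BinaryFunction

variable {α : Type} [DecidableEq α]

/-- Contraction of a single element: `(f/e)(Y) = f(Y)` on ground set `E ∖ {e}`. -/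
def contract (g : BinaryFunction α) (e : α) : BinaryFunction α :=
  ⟨g.E.erase e, g.f, g.empty_one⟩

/-- Deletion of a single element: `(f∖e)(Y) = (f(Y) + f(Y ∪ {e})) / (1 + f({e}))`
on ground set `E ∖ {e}`; well defined iff `1 + f({e}) ≠ 0` (in which case the
`if` branch below agrees with the formula, since the formula gives `1` at `∅`). -/
noncomputable def delete (g : BinaryFunction α) (e : α) : BinaryFunction α :=
  ⟨g.E.erase e,
   fun Y => if Y = ∅ then 1 else (g.f Y + g.f (Y ∪ {e})) / (1 + g.f {e}),
   by simp⟩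

/-- Contraction of a set: `(f/X)(Y) = f(Y)` on ground set `E ∖ X`. -/
def contractSet (g : BinaryFunction α) (X : Finset α) : BinaryFunction α :=
  ⟨g.E \ X, g.f, g.empty_one⟩

/-- Deletion of a set: `(f∖X)(Y) = (∑_{Z ⊆ X} f(Y ∪ Z)) / (∑_{Z ⊆ X} f(Z))`
on ground set `E ∖ X`; well defined iff `∑_{Z ⊆ X} f(Z) ≠ 0` (in which case the
`if` branch agrees with the formula, since the formula gives `1` at `∅`). -/
noncomputable def deleteSet (g : BinaryFunction α) (X : Finset α) : BinaryFunction α :=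
  ⟨g.E \ X,
   fun Y => if Y = ∅ then 1 else
     (∑ Z ∈ X.powerset, g.f (Y ∪ Z)) / (∑ Z ∈ X.powerset, g.f Z),
   by simp⟩

/-- `IsMinorOf m f`: `m` is obtained from `f` by a sequence of single-element
contractions and deletions, each step being well defined. -/
inductive IsMinorOf : BinaryFunction α → BinaryFunction α → Prop
  | refl (f : BinaryFunction α) : IsMinorOf f f
  | contract {f g : BinaryFunction α} (e : α) (he : e ∈ g.E)
      (h : IsMinorOf g f) : IsMinorOf (g.contract e) f
  | delete {f g : BinaryFunction α} (e : α) (he : e ∈ g.E)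
      (hw : 1 + g.f {e} ≠ 0) (h : IsMinorOf g f) : IsMinorOf (g.delete e) f

/-- `f` is stable: every sequence of single-element contractions and deletions applied
to `f` is well defined at every step, i.e. at every reachable minor `g`, deletion of any
ground-set element is well defined. -/
def Stable (f : BinaryFunction α) : Prop :=
  ∀ g : BinaryFunction α, IsMinorOf g f → ∀ e ∈ g.E, 1 + g.f {e} ≠ 0

/-- Isomorphism of binary functions: a bijection `φ` of ground sets with
`f(X) = f'(φ(X))` for all `X ⊆ E`. -/
def Isomorphic (g g' : BinaryFunction α) : Prop :=
  ∃ φ : α → α, Set.InjOn φ ↑g.E ∧ g.E.image φ = g'.E ∧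
    ∀ X ⊆ g.E, g.f X = g'.f (X.image φ)

/-- `f_α`: the order-one binary function on ground set `{e}` with value `α` on `{e}`. -/
def fAlpha (e : α) (a : ℝ) : BinaryFunction α :=
  ⟨{e}, fun X => if X = ∅ then 1 else a, by simp⟩

/-- The rank function `Qf(X) = log₂((∑_{Y ⊆ E} f(Y)) / (∑_{Y ⊆ E∖X} f(Y)))`. -/
noncomputable def Q (g : BinaryFunction α) (X : Finset α) : ℝ :=
  Real.logb 2 ((∑ Y ∈ g.E.powerset, g.f Y) / (∑ Y ∈ (g.E \ X).powerset, g.f Y))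

/-- `f` is rankable: for every `X ⊆ E` the denominator in `Qf(X)` is nonzero and
the quotient is strictly positive. -/
def Rankable (g : BinaryFunction α) : Prop :=
  ∀ X ⊆ g.E, (∑ Y ∈ (g.E \ X).powerset, g.f Y) ≠ 0 ∧
    0 < (∑ Y ∈ g.E.powerset, g.f Y) / (∑ Y ∈ (g.E \ X).powerset, g.f Y)

/-- `f` is `k`-polymatroidal: rankable, with `Qf` satisfying R0–R3. -/
def Polymatroidal (k : ℕ) (g : BinaryFunction α) : Prop :=
  Rankable g ∧
  (∀ X ⊆ g.E, ∃ n : ℕ, g.Q X = n) ∧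
  (∀ X ⊆ g.E, g.Q X ≤ (k : ℝ) * X.card) ∧
  (∀ X ⊆ g.E, ∀ e ∈ g.E, e ∉ X → g.Q X ≤ g.Q (insert e X)) ∧
  (∀ X ⊆ g.E, ∀ a ∈ g.E, ∀ b ∈ g.E, a ∉ X → b ∉ X → a ≠ b →
    g.Q X + g.Q (insert a (insert b X)) ≤ g.Q (insert a X) + g.Q (insert b X))

/-- `f` is linear: `{0,1}`-valued on subsets of `E`, and closed under symmetric
difference of supports. -/
def Linear (g : BinaryFunction α) : Prop :=
  (∀ X ⊆ g.E, g.f X = 0 ∨ g.f X = 1) ∧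
  (∀ X ⊆ g.E, ∀ Y ⊆ g.E, g.f X = 1 → g.f Y = 1 → g.f (symmDiff X Y) = 1)

/-- The order-two excluded minor `g`: value `1` on sets of size `0,1`, `-1` on size `2`. -/
def gTwo (a b : α) : BinaryFunction α :=
  ⟨{a, b}, fun X => if X.card = 2 then -1 else 1, by simp⟩

/-- The order-four excluded minor `f_{U_{2,4}}`: `1` on sizes `0,3`, `0` on sizes `1,2`,
`-1` on size `4`. -/
def fU24 (a b c d : α) : BinaryFunction α :=
  ⟨{a, b, c, d},
   fun X => if X.card = 0 then 1 else if X.card ≤ 2 then 0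
            else if X.card = 3 then 1 else -1,
   by simp⟩

/-- The order-two excluded minors `f_{α,β,γ}` of the `k`-polymatroidal binary functions. -/
def fABG (a b : α) (p q r : ℕ) : BinaryFunction α :=
  ⟨{a, b},
   fun X =>
     if X = ∅ then 1
     else if X = {a} then 2 ^ (p + r - q + 1) - 1
     else if X = {b} then 2 ^ (r + 1) - 1
     else 2 ^ (p + r + 1) - 2 ^ (r + 1) - 2 ^ (p + r - q + 1) + 1,
   by simp⟩

end BinaryFunction
namespace BinaryFunction

theorem IsMinorOf.contractSet {α : Type} [DecidableEq α] {f g : BinaryFunction α}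
    (h : IsMinorOf g f) (S : Finset α) (hS : S ⊆ g.E) : IsMinorOf (g.contractSet S) f := by
  induction S using Finset.induction_on with
  | empty => simpa [BinaryFunction.contractSet] using h
  | insert a S ha ih =>
    have hc := (ih ((Finset.subset_insert a S).trans hS)).contract a
      (Finset.mem_sdiff.2 ⟨hS (Finset.mem_insert_self a S), ha⟩)
    have heq : (g.contractSet S).contract a = g.contractSet (insert a S) := by
      simp only [BinaryFunction.contractSet, BinaryFunction.contract, Finset.sdiff_insert]
    rwa [heq] at hc

theorem isomorphic_fAlpha_of_E_eq_singleton {α : Type} [DecidableEq α] {g : BinaryFunction α}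
    {e : α} {a : ℝ} (hE : g.E = {e}) (hf : g.f {e} = a) : g.Isomorphic (fAlpha e a) := by
  refine ⟨id, Function.injective_id.injOn, by simpa [fAlpha] using hE, fun X hX => ?_⟩
  rw [hE, Finset.subset_singleton_iff] at hX
  rcases hX with rfl | rfl <;> simp [fAlpha, g.empty_one, hf]

theorem Isomorphic.exists_mem_f_singleton {α : Type} [DecidableEq α] {g : BinaryFunction α}
    {e : α} {a : ℝ} (h : g.Isomorphic (fAlpha e a)) : ∃ x ∈ g.E, g.f {x} = a := by
  obtain ⟨φ, -, hE, hf⟩ := h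
  have he : e ∈ g.E.image φ := by simp [hE, fAlpha]
  obtain ⟨x, hx, -⟩ := Finset.mem_image.1 he
  exact ⟨x, hx, by simpa [fAlpha] using hf {x} (Finset.singleton_subset_iff.2 hx)⟩

end BinaryFunction

open BinaryFunction in
/-- A binary function is stable iff it has no minor isomorphic to `f_{-1}`. -/
theorem stable_iff_no_fNegOne_minor {α : Type} [DecidableEq α] (f : BinaryFunction α) :
    f.Stable ↔
      ¬ ∃ m : BinaryFunction α, IsMinorOf m f ∧
          ∃ e : α, m.Isomorphic (fAlpha e (-1)) := by
  constructor
  · rintro hs ⟨m, hm, e, hiso⟩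
    obtain ⟨x, hx, hfx⟩ := hiso.exists_mem_f_singleton
    exact hs m hm x hx (by rw [hfx]; norm_num)
  · intro hno g hg e he hzero
    refine hno ⟨_, hg.contractSet (g.E.erase e) (Finset.erase_subset e g.E), e,
      isomorphic_fAlpha_of_E_eq_singleton ?_ (eq_neg_of_add_eq_zero_right hzero)⟩
    exact Finset.sdiff_erase_self he
end

section
/- Every rankable binary function is stable. -/
namespace BinaryFunction

variable {α : Type} [DecidableEq α]

/-- All partial sums of `g` over powersets of subsets of the ground set are positive. -/
def PosSums (g : BinaryFunction α) : Prop :=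
  ∀ S ⊆ g.E, 0 < ∑ Y ∈ S.powerset, g.f Y

theorem Rankable.posSums {g : BinaryFunction α} (hg : g.Rankable) : g.PosSums := by
  have htotal : 0 < ∑ Y ∈ g.E.powerset, g.f Y := by
    simpa [g.empty_one] using (hg g.E subset_rfl).2
  intro S hS
  have h := (hg (g.E \ S) Finset.sdiff_subset).2
  rw [Finset.sdiff_sdiff_eq_self hS] at h
  exact (div_pos_iff_of_pos_left htotal).1 h

theorem PosSums.one_add_pos {g : BinaryFunction α} (hg : g.PosSums) {e : α} (he : e ∈ g.E) :
    0 < 1 + g.f {e} := by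
  have h := hg {e} (Finset.singleton_subset_iff.2 he)
  rwa [← insert_empty_eq e, Finset.sum_powerset_insert (Finset.notMem_empty e),
    Finset.powerset_empty, Finset.sum_singleton, Finset.sum_singleton, g.empty_one] at h

theorem PosSums.contract {g : BinaryFunction α} (hg : g.PosSums) (e : α) :
    (g.contract e).PosSums :=
  fun S hS => hg S (hS.trans (Finset.erase_subset e g.E))

theorem delete_f {g : BinaryFunction α} {e : α} (hw : 1 + g.f {e} ≠ 0) (Y : Finset α) :
    (g.delete e).f Y = (g.f Y + g.f (insert e Y)) / (1 + g.f {e}) := by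
  rcases Y.eq_empty_or_nonempty with rfl | hY
  · simp [BinaryFunction.delete, g.empty_one, div_self hw]
  · simp [BinaryFunction.delete, hY.ne_empty]

theorem PosSums.delete {g : BinaryFunction α} (hg : g.PosSums) {e : α} (he : e ∈ g.E) :
    (g.delete e).PosSums := by
  intro S hS
  have hpos := hg.one_add_pos he
  have heS : e ∉ S := fun h => Finset.notMem_erase e g.E (hS h)
  have hsum := hg (insert e S)
    (Finset.insert_subset he (hS.trans (Finset.erase_subset e g.E)))
  rw [Finset.sum_powerset_insert heS, ← Finset.sum_add_distrib] at hsum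
  simp_rw [delete_f hpos.ne', ← Finset.sum_div]
  exact div_pos hsum hpos

theorem PosSums.of_isMinorOf {f g : BinaryFunction α} (h : IsMinorOf g f) (hf : f.PosSums) :
    g.PosSums := by
  induction h with
  | refl => exact hf
  | contract e _ _ ih => exact (ih hf).contract e
  | delete e he _ _ ih => exact (ih hf).delete he

end BinaryFunction

open BinaryFunction in
/-- Every rankable binary function is stable. -/
theorem rankable_stable {α : Type} [DecidableEq α] (f : BinaryFunction α)
    (hf : f.Rankable) : f.Stable := by
  exact fun g hg e he => ((hf.posSums.of_isMinorOf hg).one_add_pos he).ne'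
end

section
/- A binary function is rankable if and only if it has no minor isomorphic to f_α for any real α ≤ -1. -/
namespace BinaryFunction

variable {α : Type} [DecidableEq α]

/-- The sum of the values of a binary function over all subsets of `W`. -/
def subsetSum (g : BinaryFunction α) (W : Finset α) : ℝ :=
  ∑ Y ∈ W.powerset, g.f Y

lemma subsetSum_empty (g : BinaryFunction α) : g.subsetSum ∅ = 1 := by
  simp [subsetSum, g.empty_one]

lemma subsetSum_singleton (g : BinaryFunction α) (e : α) :
    g.subsetSum {e} = 1 + g.f {e} := by
  rw [subsetSum, ← insert_empty_eq, Finset.sum_powerset_insert (Finset.notMem_empty e)]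
  simp [g.empty_one]

lemma subsetSum_delete (g : BinaryFunction α) {e : α} (hw : 1 + g.f {e} ≠ 0)
    {W : Finset α} (he : e ∉ W) :
    (g.delete e).subsetSum W = g.subsetSum (insert e W) / (1 + g.f {e}) := by
  rw [subsetSum, subsetSum, Finset.sum_powerset_insert he, ← Finset.sum_add_distrib,
    Finset.sum_div]
  refine Finset.sum_congr rfl fun Y _ => ?_
  by_cases hY : Y = ∅
  · simp [delete, hY, g.empty_one, hw]
  · simp [delete, hY]

lemma rankable_iff_subsetSum_pos (g : BinaryFunction α) :
    g.Rankable ↔ ∀ W ⊆ g.E, 0 < g.subsetSum W := by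
  constructor
  · intro h W hW
    have hE : 0 < g.subsetSum g.E := by
      simpa [g.empty_one, subsetSum] using (h g.E subset_rfl).2
    have hX := (h (g.E \ W) Finset.sdiff_subset).2
    rw [Finset.sdiff_sdiff_eq_self hW] at hX
    exact (div_pos_iff_of_pos_left hE).1 hX
  · intro h X _
    have hX := h (g.E \ X) Finset.sdiff_subset
    exact ⟨hX.ne', div_pos (h g.E subset_rfl) hX⟩

lemma IsMinorOf.trans {m g f : BinaryFunction α} (hmg : IsMinorOf m g)
    (hgf : IsMinorOf g f) : IsMinorOf m f := by
  induction hmg with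
  | refl => exact hgf
  | contract e he _ ih => exact .contract e he (ih hgf)
  | delete e he hw _ ih => exact .delete e he hw (ih hgf)

lemma Rankable.of_isMinorOf {m f : BinaryFunction α} (hm : IsMinorOf m f)
    (hf : f.Rankable) : m.Rankable := by
  induction hm with
  | refl => exact hf
  | @contract _ g e he _ ih =>
    have hg := (rankable_iff_subsetSum_pos g).1 (ih hf)
    rw [rankable_iff_subsetSum_pos]
    exact fun W hW => hg W (hW.trans (Finset.erase_subset _ _))
  | @delete _ g e he hw _ ih =>
    have hg := (rankable_iff_subsetSum_pos g).1 (ih hf)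
    rw [rankable_iff_subsetSum_pos]
    intro W hW
    have heW : e ∉ W := fun h => Finset.notMem_erase e g.E (hW h)
    rw [subsetSum_delete g hw heW]
    refine div_pos (hg _ (Finset.insert_subset he (hW.trans (Finset.erase_subset _ _)))) ?_
    rw [← subsetSum_singleton]
    exact hg _ (Finset.singleton_subset_iff.2 he)

lemma isomorphic_fAlpha_of_E_eq_singleton_s5 {m : BinaryFunction α} {e : α} (hE : m.E = {e}) :
    m.Isomorphic (fAlpha e (m.f {e})) := by
  refine ⟨id, Function.injective_id.injOn, by simp [hE, fAlpha], fun X hX => ?_⟩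
  rw [hE, Finset.subset_singleton_iff] at hX
  rcases hX with rfl | rfl <;> simp [fAlpha, m.empty_one]

lemma not_rankable_of_isomorphic_fAlpha {m : BinaryFunction α} {e : α} {a : ℝ} (ha : a ≤ -1)
    (hm : m.Isomorphic (fAlpha e a)) : ¬ m.Rankable := by
  obtain ⟨φ, hφ, hE, hf⟩ := hm
  obtain ⟨x, hx⟩ : ∃ x, m.E = {x} := by
    rw [← Finset.card_eq_one, ← Finset.card_image_of_injOn hφ, hE]
    simp [fAlpha]
  intro h
  have hpos := (rankable_iff_subsetSum_pos m).1 h {x} hx.ge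
  rw [subsetSum_singleton, hf {x} hx.ge] at hpos
  simp only [fAlpha, Finset.image_singleton, Finset.singleton_ne_empty, if_false] at hpos
  linarith

lemma exists_singleton_minor_of_subsetSum_nonpos (g : BinaryFunction α) {W : Finset α}
    (hW : W ⊆ g.E) (hs : g.subsetSum W ≤ 0) :
    ∃ m, IsMinorOf m g ∧ ∃ e, m.E = {e} ∧ m.f {e} ≤ -1 := by
  induction hn : g.E.card generalizing g W with
  | zero =>
    obtain rfl : W = ∅ := by simpa [Finset.card_eq_zero.1 hn] using hW
    linarith [g.subsetSum_empty]
  | succ n ih =>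
    by_cases hproper : ∃ V ⊂ g.E, g.subsetSum V ≤ 0
    · obtain ⟨V, hV, hVs⟩ := hproper
      obtain ⟨e, he, heV⟩ := Finset.exists_of_ssubset hV
      obtain ⟨m, hm, hme⟩ := ih (g.contract e) (Finset.subset_erase.2 ⟨hV.1, heV⟩)
        hVs (by simp [contract, Finset.card_erase_of_mem he, hn])
      exact ⟨m, hm.trans (.contract e he (.refl g)), hme⟩
    · push Not at hproper
      obtain rfl : W = g.E := by
        by_contra hne
        exact (hproper W (hW.ssubset_of_ne hne)).not_ge hs
      obtain ⟨e, he⟩ : g.E.Nonempty := Finset.card_pos.1 (by omega)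
      by_cases hE : g.E = {e}
      · refine ⟨g, .refl g, e, hE, ?_⟩
        rw [hE, subsetSum_singleton] at hs
        linarith
      · have hpos := hproper {e} ((Finset.singleton_subset_iff.2 he).ssubset_of_ne (Ne.symm hE))
        rw [subsetSum_singleton] at hpos
        obtain ⟨m, hm, hme⟩ := ih (g.delete e) (W := g.E.erase e) subset_rfl
          (by
            rw [subsetSum_delete g hpos.ne' (Finset.notMem_erase e _), Finset.insert_erase he]
            exact div_nonpos_of_nonpos_of_nonneg hs hpos.le)
          (by simp [delete, Finset.card_erase_of_mem he, hn])
        exact ⟨m, hm.trans (.delete e he hpos.ne' (.refl g)), hme⟩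

end BinaryFunction

open BinaryFunction in
/-- A binary function is rankable iff it has no minor isomorphic to `f_α`
for any real `α ≤ -1`. -/
theorem rankable_iff_no_fAlpha_minor {α : Type} [DecidableEq α] (f : BinaryFunction α) :
    f.Rankable ↔
      ¬ ∃ m : BinaryFunction α, IsMinorOf m f ∧
          ∃ (e : α) (a : ℝ), a ≤ -1 ∧ m.Isomorphic (fAlpha e a) := by
  constructor
  · rintro hf ⟨m, hm, e, a, ha, hiso⟩
    exact not_rankable_of_isomorphic_fAlpha ha hiso (hf.of_isMinorOf hm)
  · intro h
    rw [rankable_iff_subsetSum_pos]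
    intro W hW
    by_contra hs
    obtain ⟨m, hm, e, hE, he⟩ := exists_singleton_minor_of_subsetSum_nonpos f hW (not_lt.1 hs)
    exact h ⟨m, hm, e, m.f {e}, he, isomorphic_fAlpha_of_E_eq_singleton_s5 hE⟩
end

section
/- Let f be a rankable binary function on ground set E, let X ⊆ E and Y ⊆ E∖X. Then the rank function of the contraction satisfies Q(f/X)(Y) = Qf(Y∪X) − Qf(X). -/
open BinaryFunction in
/-- For rankable `f`, `X ⊆ E`, `Y ⊆ E∖X`:
`Q(f/X)(Y) = Qf(Y ∪ X) − Qf(X)`. -/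
theorem Q_contractSet {α : Type} [DecidableEq α] (f : BinaryFunction α)
    (hf : f.Rankable) (X Y : Finset α) (hX : X ⊆ f.E) (hY : Y ⊆ f.E \ X) :
    (f.contractSet X).Q Y = f.Q (Y ∪ X) - f.Q X := by
  have hYX : Y ∪ X ⊆ f.E :=
    Finset.union_subset (hY.trans Finset.sdiff_subset) hX
  have total_ne_zero : ∑ Z ∈ f.E.powerset, f.f Z ≠ 0 := by
    simpa using (hf ∅ (Finset.empty_subset _)).1
  have sdiff_union : f.E \ (Y ∪ X) = (f.E \ X) \ Y := by
    rw [sdiff_sdiff_left, Finset.sup_eq_union, Finset.union_comm]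
  have compl_ne_zero := (hf X hX).1
  have compl_union_ne_zero := (hf (Y ∪ X) hYX).1
  rw [sdiff_union] at compl_union_ne_zero
  simp only [Q, contractSet, sdiff_union]
  rw [Real.logb_div compl_ne_zero compl_union_ne_zero,
    Real.logb_div total_ne_zero compl_union_ne_zero,
    Real.logb_div total_ne_zero compl_ne_zero]
  ring
end

section
/- Let f be a rankable binary function on ground set E, let X ⊆ E and Y ⊆ E∖X. Then the rank function of the deletion satisfies Q(f∖X)(Y) = Qf(Y). -/
/-- Subsets of a disjoint union `A ∪ B` split uniquely as a subset of `A` and a subset of `B`. -/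
theorem Finset.sum_powerset_union_of_disjoint {α M : Type*} [DecidableEq α] [AddCommMonoid M]
    {A B : Finset α} (h : Disjoint A B) (f : Finset α → M) :
    ∑ S ∈ (A ∪ B).powerset, f S = ∑ Y ∈ A.powerset, ∑ Z ∈ B.powerset, f (Y ∪ Z) := by
  rw [← Finset.sum_product']
  refine Finset.sum_nbij' (fun S => (S ∩ A, S ∩ B)) (fun p => p.1 ∪ p.2) ?_ ?_ ?_ ?_ ?_
  · simp
  · simp only [Finset.mem_product, Finset.mem_powerset]
    exact fun p hp => Finset.union_subset_union hp.1 hp.2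
  · simp only [Finset.mem_powerset]
    intro S hS
    rw [← Finset.inter_union_distrib_left, Finset.inter_eq_left.2 hS]
  · simp only [Finset.mem_product, Finset.mem_powerset]
    rintro ⟨Y, Z⟩ ⟨hY, hZ⟩
    simp only at hY hZ
    have hYB : Y ∩ B = ∅ := Finset.disjoint_iff_inter_eq_empty.1 (h.mono_left hY)
    have hZA : Z ∩ A = ∅ := Finset.disjoint_iff_inter_eq_empty.1 (h.symm.mono_left hZ)
    simp [Finset.union_inter_distrib_right, hYB, hZA, Finset.inter_eq_left.2 hY,
      Finset.inter_eq_left.2 hZ]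
  · simp only [Finset.mem_powerset]
    intro S hS
    rw [← Finset.inter_union_distrib_left, Finset.inter_eq_left.2 hS]

namespace BinaryFunction

theorem deleteSet_f_apply {α : Type} [DecidableEq α] (f : BinaryFunction α) {X : Finset α}
    (hX : ∑ Z ∈ X.powerset, f.f Z ≠ 0) (Y : Finset α) :
    (f.deleteSet X).f Y = (∑ Z ∈ X.powerset, f.f (Y ∪ Z)) / ∑ Z ∈ X.powerset, f.f Z := by
  by_cases hY : Y = ∅ <;> simp [deleteSet, hY, hX]

theorem sum_powerset_deleteSet {α : Type} [DecidableEq α] (f : BinaryFunction α)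
    {A X : Finset α} (hX : ∑ Z ∈ X.powerset, f.f Z ≠ 0) (h : Disjoint A X) :
    ∑ Y ∈ A.powerset, (f.deleteSet X).f Y =
      (∑ S ∈ (A ∪ X).powerset, f.f S) / ∑ Z ∈ X.powerset, f.f Z := by
  simp only [f.deleteSet_f_apply hX, Finset.sum_powerset_union_of_disjoint h, Finset.sum_div]

theorem Rankable.sum_powerset_ne_zero {α : Type} [DecidableEq α] {f : BinaryFunction α}
    (hf : f.Rankable) {X : Finset α} (hX : X ⊆ f.E) : ∑ Z ∈ X.powerset, f.f Z ≠ 0 := by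
  simpa [Finset.sdiff_sdiff_eq_self hX] using (hf (f.E \ X) Finset.sdiff_subset).1

end BinaryFunction

open BinaryFunction in
/-- For rankable `f`, `X ⊆ E`, `Y ⊆ E∖X`: `Q(f∖X)(Y) = Qf(Y)`. -/
theorem Q_deleteSet {α : Type} [DecidableEq α] (f : BinaryFunction α)
    (hf : f.Rankable) (X Y : Finset α) (hX : X ⊆ f.E) (hY : Y ⊆ f.E \ X) :
    (f.deleteSet X).Q Y = f.Q Y := by
  have hne := hf.sum_powerset_ne_zero hX
  have hE : (f.deleteSet X).E = f.E \ X := rfl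
  have hd : Disjoint (f.E \ X) X := Finset.sdiff_disjoint
  have hXY : (f.E \ X) \ Y ∪ X = f.E \ Y := by
    ext a
    have := @hX a
    have := @hY a
    simp only [Finset.mem_union, Finset.mem_sdiff] at *
    tauto
  rw [Q, Q, hE, f.sum_powerset_deleteSet hne hd,
    f.sum_powerset_deleteSet hne (hd.mono_left Finset.sdiff_subset), hXY,
    Finset.sdiff_union_of_subset hX, div_div_div_cancel_right₀ hne]
end

section
/- Let f be a {0,1}-valued binary function. If f is nonlinear, then f has a nonlinear proper minor. -/
namespace BinaryFunction

variable {α : Type} [DecidableEq α]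

/-- Deletion of `e` averages over the orbits of toggling `e`. -/
lemma delete_erase_mul (g : BinaryFunction α) {e : α} (hw : 1 + g.f {e} ≠ 0) (Z : Finset α) :
    (g.delete e).f (Z.erase e) * (1 + g.f {e}) = g.f Z + g.f (symmDiff Z {e}) := by
  have hdel : (g.delete e).f (Z.erase e) * (1 + g.f {e}) =
      g.f (Z.erase e) + g.f (insert e (Z.erase e)) := by
    by_cases hZ : Z.erase e = ∅
    · rw [hZ, (g.delete e).empty_one, g.empty_one, one_mul]
      rfl
    · simp only [delete, if_neg hZ, div_mul_cancel₀ _ hw]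
      rw [Finset.union_comm, ← Finset.insert_eq]
  rw [hdel]
  by_cases he : e ∈ Z
  · have hs : symmDiff Z {e} = Z.erase e := by ext a; simp [Finset.mem_symmDiff]; grind
    rw [hs, Finset.insert_erase he, add_comm]
  · have hs : symmDiff Z {e} = insert e Z := by ext a; simp [Finset.mem_symmDiff]; grind
    rw [hs, Finset.erase_eq_of_notMem he]

lemma erase_symmDiff (X Y : Finset α) (e : α) :
    (symmDiff X Y).erase e = symmDiff (X.erase e) (Y.erase e) := by
  ext a; simp [Finset.mem_symmDiff]; grind

lemma symmDiff_subset {X Y E : Finset α} (hX : X ⊆ E) (hY : Y ⊆ E) : symmDiff X Y ⊆ E := by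
  intro a; simp only [Finset.mem_symmDiff]; grind

/-- A linear binary function equal to `1` on all singletons is constantly `1`. -/
lemma Linear.eq_one_of_singletons {g : BinaryFunction α} (hg : g.Linear)
    (hs : ∀ a ∈ g.E, g.f {a} = 1) {Z : Finset α} (hZ : Z ⊆ g.E) : g.f Z = 1 := by
  induction Z using Finset.induction_on with
  | empty => exact g.empty_one
  | insert a S ha ih =>
    obtain ⟨haE, hSE⟩ := Finset.insert_subset_iff.1 hZ
    have h := hg.2 S hSE {a} (by simpa using haE) (ih hSE) (hs a haE)
    have hs : symmDiff S {a} = insert a S := by ext b; simp [Finset.mem_symmDiff]; grind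
    rwa [hs] at h

/-- If toggling any element flips the value between `0` and `1`, then `g` is the indicator of
the even-size sets. -/
lemma eq_ite_even_of_toggle {g : BinaryFunction α}
    (ht : ∀ e ∈ g.E, ∀ Z ⊆ g.E, g.f Z + g.f (symmDiff Z {e}) = 1) {Z : Finset α} (hZ : Z ⊆ g.E) :
    g.f Z = if Even Z.card then 1 else 0 := by
  induction Z using Finset.induction_on with
  | empty => simp [g.empty_one]
  | insert a S ha ih =>
    obtain ⟨haE, hSE⟩ := Finset.insert_subset_iff.1 hZ
    have h := ht a haE S hSE
    have hs : symmDiff S {a} = insert a S := by ext b; simp [Finset.mem_symmDiff]; grind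
    rw [hs, ih hSE] at h
    rw [Finset.card_insert_of_notMem ha]
    by_cases hev : Even S.card <;> simp [hev, Nat.even_add_one] at h ⊢ <;> linarith

lemma even_card_symmDiff {X Y : Finset α} (hX : Even X.card) (hY : Even Y.card) :
    Even (symmDiff X Y).card := by
  have h : (symmDiff X Y).card = (X \ Y).card + (Y \ X).card :=
    Finset.card_union_of_disjoint disjoint_sdiff_sdiff
  have h₁ := Finset.card_sdiff_add_card_inter X Y
  have h₂ := Finset.card_sdiff_add_card_inter Y X
  rw [Finset.inter_comm] at h₂
  grind

lemma linear_of_toggle {g : BinaryFunction α}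
    (ht : ∀ e ∈ g.E, ∀ Z ⊆ g.E, g.f Z + g.f (symmDiff Z {e}) = 1) : g.Linear := by
  refine ⟨fun X hX => ?_, fun X hX Y hY h₁ h₂ => ?_⟩
  · rw [eq_ite_even_of_toggle ht hX]
    split_ifs <;> simp
  · rw [eq_ite_even_of_toggle ht hX] at h₁
    rw [eq_ite_even_of_toggle ht hY] at h₂
    rw [eq_ite_even_of_toggle ht (symmDiff_subset hX hY),
      if_pos (even_card_symmDiff (by simpa using h₁) (by simpa using h₂))]

/-- If `g` takes value `1` at a singleton `{e}` and both `g/e` and `g∖e` are linear, then so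
is `g`. -/
lemma linear_of_singleton_eq_one {g : BinaryFunction α}
    (h01 : ∀ X ⊆ g.E, g.f X = 0 ∨ g.f X = 1) {e : α} (he1 : g.f {e} = 1)
    (hc : (g.contract e).Linear) (hd : (g.delete e).Linear) (he : e ∈ g.E) : g.Linear := by
  have key : ∀ Z ⊆ g.E, g.f (Z.erase e) = g.f Z := by
    intro Z hZ
    have hmul := delete_erase_mul g (e := e) (by rw [he1]; norm_num) Z
    rw [he1] at hmul
    have hv := hd.1 (Z.erase e) (Finset.erase_subset_erase e hZ)
    have hZ01 := h01 Z hZ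
    have ht01 := h01 _ (symmDiff_subset hZ (Finset.singleton_subset_iff.2 he))
    have heq : g.f Z = g.f (symmDiff Z {e}) := by
      rcases hv with hv | hv <;> rcases hZ01 with h₁ | h₁ <;> rcases ht01 with h₂ | h₂ <;>
        rw [hv, h₁, h₂] at hmul <;> norm_num at hmul <;> rw [h₁, h₂]
    by_cases hm : e ∈ Z
    · have hs : symmDiff Z {e} = Z.erase e := by ext a; simp [Finset.mem_symmDiff]; grind
      rw [heq, hs]
    · rw [Finset.erase_eq_of_notMem hm]
  refine ⟨h01, fun X hX Y hY h₁ h₂ => ?_⟩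
  rw [← key _ (symmDiff_subset hX hY), erase_symmDiff]
  exact hc.2 _ (Finset.erase_subset_erase e hX) _ (Finset.erase_subset_erase e hY)
    ((key X hX).trans h₁) ((key Y hY).trans h₂)

/-- If `g` is `0` on all singletons and every single-element deletion of `g` is linear, then so
is `g`. -/
lemma linear_of_singletons_eq_zero {g : BinaryFunction α}
    (h01 : ∀ X ⊆ g.E, g.f X = 0 ∨ g.f X = 1) (h0 : ∀ e ∈ g.E, g.f {e} = 0)
    (hd : ∀ e ∈ g.E, (g.delete e).Linear) : g.Linear := by
  by_contra hnl
  have hsum : ∀ e ∈ g.E, ∀ Z, (g.delete e).f (Z.erase e) = g.f Z + g.f (symmDiff Z {e}) := by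
    intro e he Z
    have h := delete_erase_mul g (e := e) (by rw [h0 e he]; norm_num) Z
    rwa [h0 e he, add_zero, mul_one] at h
  have hone : ∀ e ∈ g.E, ∀ Z ⊆ g.E, g.f Z = 1 → (g.delete e).f (Z.erase e) = 1 := by
    intro e he Z hZ h₁
    have h := hsum e he Z
    have ht := h01 _ (symmDiff_subset hZ (Finset.singleton_subset_iff.2 he))
    rcases (hd e he).1 (Z.erase e) (Finset.erase_subset_erase e hZ) with hv | hv
    · rcases ht with ht | ht <;> rw [hv, h₁, ht] at h <;> norm_num at h
    · exact hv
  obtain ⟨X, hX, Y, hY, hX1, hY1, hW1⟩ : ∃ X ⊆ g.E, ∃ Y ⊆ g.E, g.f X = 1 ∧ g.f Y = 1 ∧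
      g.f (symmDiff X Y) ≠ 1 := by
    by_contra! hcon
    exact hnl ⟨h01, hcon⟩
  have hWE := symmDiff_subset hX hY
  have hW0 := (h01 _ hWE).resolve_right hW1
  have hWe : ∀ e ∈ g.E, (g.delete e).f ((symmDiff X Y).erase e) = 1 := by
    intro e he
    rw [erase_symmDiff]
    exact (hd e he).2 _ (Finset.erase_subset_erase e hX) _ (Finset.erase_subset_erase e hY)
      (hone e he X hX hX1) (hone e he Y hY hY1)
  have hnbr : ∀ e ∈ g.E, g.f (symmDiff (symmDiff X Y) {e}) = 1 := by
    intro e he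
    have h := hsum e he (symmDiff X Y)
    rw [hWe e he, hW0, zero_add] at h
    exact h.symm
  refine hnl (linear_of_toggle fun e he Z hZ => ?_)
  rw [← hsum e he Z]
  refine (hd e he).eq_one_of_singletons (fun a ha => ?_) (Finset.erase_subset_erase e hZ)
  obtain ⟨hae, haE⟩ := Finset.mem_erase.1 ha
  have hnE := symmDiff_subset hWE (Finset.singleton_subset_iff.2 haE)
  have h := (hd e he).2 _ (Finset.erase_subset_erase e hWE) _ (Finset.erase_subset_erase e hnE)
    (hWe e he) (hone e he _ hnE (hnbr a haE))
  rwa [← erase_symmDiff, symmDiff_symmDiff_cancel_left,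
    Finset.erase_eq_of_notMem (by simpa using hae.symm)] at h

end BinaryFunction

open BinaryFunction in
/-- A `{0,1}`-valued nonlinear binary function has a nonlinear proper minor. -/
theorem nonlinear_has_nonlinear_proper_minor {α : Type} [DecidableEq α]
    (f : BinaryFunction α) (h01 : ∀ X ⊆ f.E, f.f X = 0 ∨ f.f X = 1)
    (hnl : ¬ f.Linear) :
    ∃ m : BinaryFunction α, IsMinorOf m f ∧ m.E.card < f.E.card ∧ ¬ m.Linear := by
  by_contra! hcon
  have hd : ∀ e ∈ f.E, (f.delete e).Linear := by
    intro e he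
    refine hcon _ (.delete e he ?_ (.refl f)) (Finset.card_erase_lt_of_mem he)
    rcases h01 {e} (Finset.singleton_subset_iff.2 he) with h | h <;> rw [h] <;> norm_num
  by_cases h1 : ∃ e ∈ f.E, f.f {e} = 1
  · obtain ⟨e, he, he1⟩ := h1
    exact hnl (linear_of_singleton_eq_one h01 he1
      (hcon _ (.contract e he (.refl f)) (Finset.card_erase_lt_of_mem he)) (hd e he) he)
  · push Not at h1
    exact hnl (linear_of_singletons_eq_zero h01
      (fun e he => (h01 {e} (Finset.singleton_subset_iff.2 he)).resolve_right (h1 e he)) hd)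
end
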